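/- arXiv:2407.02316 — 3 statements merged into one kernel-verified Lean document; each statement's English description precedes it below -/
import Mathlib

section
/- Let G be a finite group, H ≤ G, and S ⊆ G with S ∩ H = ∅ and HSH = S, and suppose there exists a subgroup K with H < K < G such that H(S∖K)H is a union of double cosets of K in G. Let Γ = Cos(G,H,S) and let ℬ be the block system whose blocks are the sets of left cosets of H contained in a left coset of K. Then Cos(G,H,S) ≅ Γ/ℬ ≀ Γ[K] ≅ Cos(G,K,S∖K) ≀ Cos(K,H,S∩K), where Γ[K] denotes the subdigraph induced on the block consisting of the left cosets of H contained in K. -/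
open scoped Pointwise

namespace DCG

/-- An isomorphism of digraphs: a bijection of vertex sets mapping arcs to arcs and
non-arcs to non-arcs. -/
structure Iso {V W : Type*} (Γ₁ : Digraph V) (Γ₂ : Digraph W) extends V ≃ W where
  adj_iff : ∀ u v : V, Γ₂.Adj (toEquiv u) (toEquiv v) ↔ Γ₁.Adj u v

/-- The wreath product of two digraphs. -/
def wr {V₁ V₂ : Type*} (Γ₁ : Digraph V₁) (Γ₂ : Digraph V₂) : Digraph (V₁ × V₂) where
  Adj p q := Γ₁.Adj p.1 q.1 ∨ (p.1 = q.1 ∧ Γ₂.Adj p.2 q.2)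

/-- The automorphism group of a digraph, as a subgroup of the symmetric group on the
vertices. -/
def Aut {V : Type*} (Γ : Digraph V) : Subgroup (Equiv.Perm V) where
  carrier := {e | ∀ u v : V, Γ.Adj (e u) (e v) ↔ Γ.Adj u v}
  one_mem' := by intro u v; rfl
  mul_mem' := by
    intro a b ha hb u v
    simpa [Equiv.Perm.mul_apply] using ((ha (b u) (b v)).trans (hb u v))
  inv_mem' := by
    intro a ha u v
    simpa using (ha (a⁻¹ u) (a⁻¹ v)).symm

/-- A subgroup of the symmetric group is transitive. -/
def IsTransitiveSub {V : Type*} (A : Subgroup (Equiv.Perm V)) : Prop :=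
  ∀ u v : V, ∃ g ∈ A, (g : Equiv.Perm V) u = v

/-- A digraph is vertex-transitive when its automorphism group is transitive. -/
def IsVertexTransitive {V : Type*} (Γ : Digraph V) : Prop :=
  IsTransitiveSub (Aut Γ)

/-- `ℬ` is a block system of the permutation group `A`: an `A`-invariant partition of the
point set. -/
def IsBlockSystemOf {V : Type*} (A : Subgroup (Equiv.Perm V)) (ℬ : Set (Set V)) : Prop :=
  Setoid.IsPartition ℬ ∧ ∀ g ∈ A, ∀ B ∈ ℬ, (g : Equiv.Perm V) '' B ∈ ℬ

/-- The block quotient digraph of `Γ` with respect to a set `ℬ` of sets of vertices. -/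
def quotDgr {V : Type*} (Γ : Digraph V) (ℬ : Set (Set V)) : Digraph ℬ where
  Adj B B' := B ≠ B' ∧ ∃ x ∈ (B : Set V), ∃ y ∈ (B' : Set V), Γ.Adj x y

/-- The subdigraph of `Γ` induced on a set `B` of vertices. -/
def induce {V : Type*} (Γ : Digraph V) (B : Set V) : Digraph B where
  Adj x y := Γ.Adj (x : V) (y : V)

/-- The double coset digraph `Cos(G,H,S)`. -/
def cos (G : Type*) [Group G] (H : Subgroup G) (S : Set G) : Digraph (G ⧸ H) where
  Adj a b := ∃ g s : G, s ∈ S ∧ a = QuotientGroup.mk g ∧ b = QuotientGroup.mk (g * s)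

/-- The Cayley digraph `Cay(G,S)`. -/
def cay (G : Type*) [Group G] (S : Set G) : Digraph G where
  Adj a b := ∃ s ∈ S, b = a * s

/-- The digraph on `n` vertices with no arcs. -/
def empt (n : ℕ) : Digraph (Fin n) where
  Adj _ _ := False

/-- The wreath product of two permutation groups, in its imprimitive action. -/
def permWr {X Y : Type*} (A : Subgroup (Equiv.Perm X)) (B : Subgroup (Equiv.Perm Y)) :
    Subgroup (Equiv.Perm (X × Y)) where
  carrier := {e | ∃ g ∈ A, ∃ h : X → Equiv.Perm Y, (∀ x, h x ∈ B) ∧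
    ∀ p : X × Y, e p = (g p.1, h p.1 p.2)}
  one_mem' := ⟨1, A.one_mem, fun _ => 1, fun _ => B.one_mem, fun _ => rfl⟩
  mul_mem' := by
    rintro a b ⟨g₁, hg₁, h₁, hh₁, he₁⟩ ⟨g₂, hg₂, h₂, hh₂, he₂⟩
    refine ⟨g₁ * g₂, A.mul_mem hg₁ hg₂, fun x => h₁ (g₂ x) * h₂ x,
      fun x => B.mul_mem (hh₁ _) (hh₂ _), fun p => ?_⟩
    simp [Equiv.Perm.mul_apply, he₁, he₂]
  inv_mem' := by
    rintro a ⟨g, hg, h, hh, he⟩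
    refine ⟨g⁻¹, A.inv_mem hg, fun x => (h (g⁻¹ x))⁻¹,
      fun x => B.inv_mem (hh _), fun p => ?_⟩
    have key : a (g⁻¹ p.1, (h (g⁻¹ p.1))⁻¹ p.2) = p := by
      rw [he]
      simp [Equiv.Perm.mul_apply]
    calc a⁻¹ p = a⁻¹ (a (g⁻¹ p.1, (h (g⁻¹ p.1))⁻¹ p.2)) := by rw [key]
    _ = (g⁻¹ p.1, (h (g⁻¹ p.1))⁻¹ p.2) := by simp

/-- The induced action of a permutation group `A` on a system `ℬ` of sets of points,
as a subgroup of the symmetric group on `ℬ`. -/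
def inducedOn {X : Type*} (A : Subgroup (Equiv.Perm X)) (ℬ : Set (Set X)) :
    Subgroup (Equiv.Perm ℬ) where
  carrier := {σ | ∃ g ∈ A, ∀ B : ℬ, ((σ B : Set X)) = (g : Equiv.Perm X) '' (B : Set X)}
  one_mem' := ⟨1, A.one_mem, by simp⟩
  mul_mem' := by
    rintro a b ⟨g₁, hg₁, h₁⟩ ⟨g₂, hg₂, h₂⟩
    refine ⟨g₁ * g₂, A.mul_mem hg₁ hg₂, fun B => ?_⟩
    have : ((a * b) B : Set X) = (a (b B) : Set X) := rfl
    rw [this, h₁, h₂]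
    ext x
    simp [Equiv.Perm.mul_apply, Set.image_image]
  inv_mem' := by
    rintro a ⟨g, hg, h⟩
    refine ⟨g⁻¹, A.inv_mem hg, fun B => ?_⟩
    have hb : ((a (a⁻¹ B)) : Set X) = (g : Equiv.Perm X) '' ((a⁻¹ B : ℬ) : Set X) := h _
    have hab : a (a⁻¹ B) = B := by simp
    rw [hab] at hb
    rw [hb]
    ext x
    simp

/-- A digraph is complete if every ordered pair of distinct vertices is an arc. -/
def IsComplete {V : Type*} (Γ : Digraph V) : Prop := ∀ u v : V, u ≠ v → Γ.Adj u v

/-- A digraph has no arcs. -/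
def HasNoArcs {V : Type*} (Γ : Digraph V) : Prop := ∀ u v : V, ¬ Γ.Adj u v

/-- A digraph is reducible if two distinct vertices have the same out-neighbours and the
same in-neighbours. -/
def Reducible {V : Type*} (Γ : Digraph V) : Prop :=
  ∃ u v : V, u ≠ v ∧ (∀ w, Γ.Adj u w ↔ Γ.Adj v w) ∧ (∀ w, Γ.Adj w u ↔ Γ.Adj w v)

/-- A regular subgroup of a symmetric group: transitive, and only the identity fixes a
point. -/
def IsRegularSub {X : Type*} [Nonempty X] (L : Subgroup (Equiv.Perm X)) : Prop :=
  IsTransitiveSub L ∧ ∀ g ∈ L, (∃ x : X, (g : Equiv.Perm X) x = x) → g = 1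

/-- A block system for a multiplicative action: an invariant partition. -/
def IsBlockSystemMul (G : Type*) [Group G] {X : Type*} [MulAction G X]
    (ℬ : Set (Set X)) : Prop :=
  Setoid.IsPartition ℬ ∧ ∀ (g : G), ∀ B ∈ ℬ, g • B ∈ ℬ

/-- `Γ` is isomorphic to a nontrivial wreath product of two vertex-transitive digraphs,
each with at least two vertices. -/
def IsNontrivialWreathProduct {V : Type*} (Γ : Digraph V) : Prop :=
  ∃ (V₁ V₂ : Type) (Γ₁ : Digraph V₁) (Γ₂ : Digraph V₂),
    IsVertexTransitive Γ₁ ∧ IsVertexTransitive Γ₂ ∧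
    2 ≤ Nat.card V₁ ∧ 2 ≤ Nat.card V₂ ∧ Nonempty (Iso Γ (wr Γ₁ Γ₂))

/-- The block quotient of a digraph on `G` by the partition of `G` into left cosets
of `H`, realized on the vertex set `G ⧸ H`. -/
def cosetQuot (G : Type*) [Group G] (H : Subgroup G) (Γ : Digraph G) : Digraph (G ⧸ H) where
  Adj a b := a ≠ b ∧ ∃ x y : G, (QuotientGroup.mk x : G ⧸ H) = a ∧
    (QuotientGroup.mk y : G ⧸ H) = b ∧ Γ.Adj x y

/-- Composition of digraph isomorphisms. -/
def Iso.trans {U V W : Type*} {Γ₁ : Digraph U} {Γ₂ : Digraph V} {Γ₃ : Digraph W}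
    (e : Iso Γ₁ Γ₂) (f : Iso Γ₂ Γ₃) : Iso Γ₁ Γ₃ where
  toEquiv := e.toEquiv.trans f.toEquiv
  adj_iff u v := (f.adj_iff _ _).trans (e.adj_iff u v)

/-- Isomorphic factors give isomorphic wreath products. -/
def Iso.wrCongr {V₁ V₂ W₁ W₂ : Type*} {Γ₁ : Digraph V₁} {Γ₂ : Digraph V₂}
    {Δ₁ : Digraph W₁} {Δ₂ : Digraph W₂} (e : Iso Γ₁ Δ₁) (f : Iso Γ₂ Δ₂) :
    Iso (wr Γ₁ Γ₂) (wr Δ₁ Δ₂) where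
  toEquiv := e.toEquiv.prodCongr f.toEquiv
  adj_iff _ _ := or_congr (e.adj_iff _ _)
    (and_congr e.toEquiv.injective.eq_iff (f.adj_iff _ _))

section DoubleCosets

variable {G : Type*} [Group G] {H K : Subgroup G} {S : Set G}

theorem mul_mul_eq_of_forall (h : ∀ a ∈ H, ∀ s ∈ S, ∀ b ∈ H, a * s * b ∈ S) :
    (H : Set G) * S * (H : Set G) = S := by
  refine Set.Subset.antisymm ?_ fun s hs => ?_
  · rintro _ ⟨_, ⟨a, ha, s, hs, rfl⟩, b, hb, rfl⟩
    exact h a ha s hs b hb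
  · exact ⟨s, ⟨1, H.one_mem, s, hs, one_mul s⟩, 1, H.one_mem, mul_one s⟩

theorem mul_mem_of_mul_mul_eq (hS : (H : Set G) * S * (H : Set G) = S) {a s b : G}
    (ha : a ∈ H) (hs : s ∈ S) (hb : b ∈ H) : a * s * b ∈ S :=
  hS ▸ Set.mul_mem_mul (Set.mul_mem_mul ha hs) hb

theorem cos_adj_mk_iff (hS : (H : Set G) * S * (H : Set G) = S) (x y : G) :
    (cos G H S).Adj (x : G ⧸ H) (y : G ⧸ H) ↔ x⁻¹ * y ∈ S := by
  constructor
  · rintro ⟨g, s, hs, hx, hy⟩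
    have := mul_mem_of_mul_mul_eq hS (QuotientGroup.eq.1 hx) hs (QuotientGroup.eq.1 hy.symm)
    simpa [mul_assoc] using this
  · exact fun h => ⟨x, x⁻¹ * y, h, rfl, by simp⟩

theorem mul_diff_mul_eq (hS : (H : Set G) * S * (H : Set G) = S) (hHK : H ≤ K) :
    (H : Set G) * (S \ (K : Set G)) * (H : Set G) = S \ (K : Set G) :=
  mul_mul_eq_of_forall fun a ha s hs b hb =>
    ⟨mul_mem_of_mul_mul_eq hS ha hs.1 hb, fun h => hs.2 <| by
      rwa [SetLike.mem_coe, K.mul_mem_cancel_right (hHK hb),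
        K.mul_mem_cancel_left (hHK ha)] at h⟩

theorem subgroupOf_mul_mul_eq (hS : (H : Set G) * S * (H : Set G) = S) :
    (H.subgroupOf K : Set K) * {k : K | (k : G) ∈ S} * (H.subgroupOf K : Set K) =
      {k : K | (k : G) ∈ S} :=
  mul_mul_eq_of_forall fun _ ha _ hs _ hb => mul_mem_of_mul_mul_eq hS ha hs hb

theorem mk_mem_image_smul_iff (hHK : H ≤ K) (g x : G) :
    (x : G ⧸ H) ∈ (QuotientGroup.mk : G → G ⧸ H) '' (g • (K : Set G)) ↔
      (g : G ⧸ K) = (x : G ⧸ K) := by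
  rw [QuotientGroup.eq]
  constructor
  · rintro ⟨_, ⟨k, hk, rfl⟩, h⟩
    have := K.mul_mem hk (hHK (QuotientGroup.eq.1 h))
    simpa [mul_assoc] using this
  · exact fun h => ⟨x, ⟨g⁻¹ * x, h, by simp⟩, rfl⟩

/-- If `S \ K` is a union of double cosets of `K`, then `Cos(G,H,S)` is a wreath product. -/
theorem nonempty_iso_cos_wr (hS : (H : Set G) * S * (H : Set G) = S) (hHK : H ≤ K)
    (hT : (K : Set G) * (S \ (K : Set G)) * (K : Set G) = S \ (K : Set G)) :
    Nonempty (Iso (cos G H S)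
        (wr (cos G K (S \ (K : Set G)))
          (cos K (H.subgroupOf K) {k : K | (k : G) ∈ S}))) := by
  refine ⟨⟨Subgroup.quotientEquivProdOfLE' hHK Quotient.out Quotient.out_eq', fun u v => ?_⟩⟩
  induction u using QuotientGroup.induction_on with | H x =>
  induction v using QuotientGroup.induction_on with | H y =>
  rw [cos_adj_mk_iff hS]
  refine (or_congr (cos_adj_mk_iff hT x y)
    (and_congr_right fun _ => cos_adj_mk_iff (subgroupOf_mul_mul_eq hS) _ _)).trans ?_
  change _ ∨ (x : G ⧸ K) = (y : G ⧸ K) ∧ (_ : G) ∈ S ↔ _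
  have key (h : (x : G ⧸ K) = (y : G ⧸ K)) :
      ((Quotient.out (x : G ⧸ K))⁻¹ * x)⁻¹ * ((Quotient.out (y : G ⧸ K))⁻¹ * y) =
        x⁻¹ * y := by
    rw [h]; group
  constructor
  · rintro (h | ⟨h, h'⟩)
    · exact h.1
    · exact Set.mem_of_eq_of_mem (key h).symm h'
  · intro h
    by_cases hK : x⁻¹ * y ∈ K
    · have hq := QuotientGroup.eq.2 hK
      exact Or.inr ⟨hq, Set.mem_of_eq_of_mem (key hq) h⟩
    · exact Or.inl ⟨h, hK⟩

/-- The block quotient by the left cosets of `K` is a double coset digraph of `K`. -/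
theorem nonempty_iso_cos_quotDgr (hS : (H : Set G) * S * (H : Set G) = S) (hHK : H ≤ K)
    (hT : (K : Set G) * (S \ (K : Set G)) * (K : Set G) = S \ (K : Set G)) :
    Nonempty (Iso (cos G K (S \ (K : Set G)))
      (quotDgr (cos G H S)
        {B | ∃ g : G, B = (QuotientGroup.mk : G → G ⧸ H) '' (g • (K : Set G))})) := by
  let f : G ⧸ K →
      {B | ∃ g : G, B = (QuotientGroup.mk : G → G ⧸ H) '' (g • (K : Set G))} :=
    fun q => ⟨(QuotientGroup.mk : G → G ⧸ H) '' (q.out • (K : Set G)), q.out, rfl⟩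
  have mem_f (q : G ⧸ K) (x : G) : (x : G ⧸ H) ∈ (f q : Set (G ⧸ H)) ↔ q = (x : G ⧸ K) := by
    rw [mk_mem_image_smul_iff hHK, QuotientGroup.out_eq']
  have hf : Function.Bijective f := by
    constructor
    · intro p q h
      induction p using QuotientGroup.induction_on with | H x =>
      exact ((mem_f q x).1 (h ▸ (mem_f _ x).2 rfl)).symm
    · rintro ⟨_, g, rfl⟩
      refine ⟨(g : G ⧸ K), Subtype.ext <| Set.ext fun z => ?_⟩
      induction z using QuotientGroup.induction_on with | H x =>
      rw [mem_f, mk_mem_image_smul_iff hHK]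
  refine ⟨⟨Equiv.ofBijective f hf, fun p q => ?_⟩⟩
  change (f p ≠ f q ∧ ∃ x ∈ (f p : Set (G ⧸ H)), ∃ y ∈ (f q : Set (G ⧸ H)), _) ↔ _
  rw [hf.injective.ne_iff]
  constructor
  · rintro ⟨hne, u, hu, v, hv, h⟩
    induction u using QuotientGroup.induction_on with | H x =>
    induction v using QuotientGroup.induction_on with | H y =>
    rw [mem_f] at hu hv
    subst hu hv
    rw [cos_adj_mk_iff hS] at h
    exact (cos_adj_mk_iff hT x y).2 ⟨h, fun hK => hne (QuotientGroup.eq.2 hK)⟩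
  · induction p using QuotientGroup.induction_on with | H x =>
    induction q using QuotientGroup.induction_on with | H y =>
    intro h
    rw [cos_adj_mk_iff hT] at h
    exact ⟨fun he => h.2 (QuotientGroup.eq.1 he), x, (mem_f _ x).2 rfl, y, (mem_f _ y).2 rfl,
      (cos_adj_mk_iff hS x y).2 h.1⟩

/-- The subdigraph induced on the left cosets of `H` in `K` is a double coset digraph
of `K`. -/
theorem nonempty_iso_cos_induce (hS : (H : Set G) * S * (H : Set G) = S) :
    Nonempty (Iso (cos K (H.subgroupOf K) {k : K | (k : G) ∈ S})
      (induce (cos G H S) ((QuotientGroup.mk : G → G ⧸ H) '' (K : Set G)))) := by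
  let f : K ⧸ H.subgroupOf K → (QuotientGroup.mk : G → G ⧸ H) '' (K : Set G) :=
    Quotient.lift (fun k => ⟨((k : G) : G ⧸ H), k, k.2, rfl⟩) fun a b h =>
      Subtype.ext <| QuotientGroup.eq.2 (QuotientGroup.leftRel_apply (s := H.subgroupOf K).1 h)
  have hf : Function.Bijective f := by
    constructor
    · intro p q h
      induction p using QuotientGroup.induction_on with | H x =>
      induction q using QuotientGroup.induction_on with | H y =>
      exact QuotientGroup.eq.2 (QuotientGroup.eq.1 (Subtype.ext_iff.1 h) : (x : G)⁻¹ * y ∈ H)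
    · rintro ⟨_, k, hk, rfl⟩
      exact ⟨((⟨k, hk⟩ : K) : K ⧸ H.subgroupOf K), rfl⟩
  refine ⟨⟨Equiv.ofBijective f hf, fun p q => ?_⟩⟩
  induction p using QuotientGroup.induction_on with | H x =>
  induction q using QuotientGroup.induction_on with | H y =>
  exact (cos_adj_mk_iff hS (x : G) y).trans (cos_adj_mk_iff (subgroupOf_mul_mul_eq hS) x y).symm

end DoubleCosets

/-- If `H < K < G` and `H(S∖K)H` is a union of double cosets of `K` in `G`,
then `Cos(G,H,S) ≅ Γ/ℬ ≀ Γ[K] ≅ Cos(G,K,S∖K) ≀ Cos(K,H,S∩K)`, where `ℬ` is the block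
system of left cosets of `K` (viewed as sets of left cosets of `H`). -/
theorem statement_4 {G : Type*} [Group G] [Finite G] (H K : Subgroup G) (S : Set G)
    (hdisj : S ∩ (H : Set G) = ∅) (hS : (H : Set G) * S * (H : Set G) = S)
    (hHK : H < K) (hKtop : K ≠ ⊤)
    (hunion : (K : Set G) * ((H : Set G) * (S \ (K : Set G)) * (H : Set G)) * (K : Set G) =
      (H : Set G) * (S \ (K : Set G)) * (H : Set G)) :
    Nonempty (Iso (cos G H S)
        (wr (quotDgr (cos G H S)
            {B | ∃ g : G, B = (QuotientGroup.mk : G → G ⧸ H) '' (g • (K : Set G))})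
          (induce (cos G H S) ((QuotientGroup.mk : G → G ⧸ H) '' (K : Set G))))) ∧
    Nonempty (Iso (cos G H S)
        (wr (cos G K (S \ (K : Set G)))
          (cos K (H.subgroupOf K) {k : K | (k : G) ∈ S}))) := by
  have hT : (K : Set G) * (S \ (K : Set G)) * (K : Set G) = S \ (K : Set G) := by
    rwa [mul_diff_mul_eq hS hHK.le] at hunion
  obtain ⟨e⟩ := nonempty_iso_cos_wr hS hHK.le hT
  obtain ⟨e₁⟩ := nonempty_iso_cos_quotDgr hS hHK.le hT
  obtain ⟨e₂⟩ := nonempty_iso_cos_induce (K := K) hS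
  exact ⟨⟨e.trans (e₁.wrCongr e₂)⟩, ⟨e⟩⟩

end DCG
end

section
/- Let G be a finite group. Let Cos(G) be the set of double coset digraphs Cos(G,H,S) with 1 < H ≤ G, H ∩ S = ∅, and S = HSH, and let Reducible(G) be the set of reducible Cayley digraphs of G. Define γ : Cos(G) → Reducible(G) by γ(Cos(G,H,S)) = Cay(G,S). Then γ is well defined and onto, and γ(Cos(G,H₁,S₁)) = γ(Cos(G,H₂,S₂)) if and only if S₁ = S₂ and ⟨H₁,H₂⟩S₁⟨H₁,H₂⟩ = S₁, where ⟨H₁,H₂⟩ is the subgroup generated by H₁ and H₂. -/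
open scoped Pointwise

namespace DCG

/-- The elements of `G` that stabilize `S` under both left and right multiplication. -/
def biStabilizer {G : Type*} [Group G] (S : Set G) : Subgroup G :=
  MulAction.stabilizer G S ⊓ (MulAction.stabilizer Gᵐᵒᵖ S).unop

theorem mem_biStabilizer {G : Type*} [Group G] {S : Set G} {h : G} :
    h ∈ biStabilizer S ↔ (∀ x, h * x ∈ S ↔ x ∈ S) ∧ ∀ x, x * h ∈ S ↔ x ∈ S := by
  rw [biStabilizer, Subgroup.mem_inf, Subgroup.mem_unop, MulAction.mem_stabilizer_set,
    MulAction.mem_stabilizer_set]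
  rfl

theorem mul_mul_eq_iff_le_biStabilizer {G : Type*} [Group G] {H : Subgroup G} {S : Set G} :
    (H : Set G) * S * (H : Set G) = S ↔ H ≤ biStabilizer S := by
  constructor
  · intro hS h hh
    have left : ∀ k ∈ H, ∀ x ∈ S, k * x ∈ S := fun k hk x hx => by
      rw [← hS]
      simpa using Set.mul_mem_mul (Set.mul_mem_mul (SetLike.mem_coe.2 hk) hx) H.one_mem
    have right : ∀ k ∈ H, ∀ x ∈ S, x * k ∈ S := fun k hk x hx => by
      rw [← hS]
      simpa using Set.mul_mem_mul (Set.mul_mem_mul H.one_mem hx) (SetLike.mem_coe.2 hk)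
    refine mem_biStabilizer.2 ⟨fun x => ⟨fun hx => ?_, left h hh x⟩,
      fun x => ⟨fun hx => ?_, right h hh x⟩⟩
    · simpa using left h⁻¹ (H.inv_mem hh) _ hx
    · simpa using right h⁻¹ (H.inv_mem hh) _ hx
  · intro hH
    refine Set.Subset.antisymm ?_ fun x hx => ?_
    · rintro _ ⟨_, ⟨a, ha, x, hx, rfl⟩, b, hb, rfl⟩
      exact ((mem_biStabilizer.1 (hH hb)).2 _).2 (((mem_biStabilizer.1 (hH ha)).1 _).2 hx)
    · simpa using Set.mul_mem_mul (Set.mul_mem_mul H.one_mem hx) H.one_mem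

theorem disjoint_biStabilizer {G : Type*} [Group G] {S : Set G} (h1 : (1 : G) ∉ S) :
    (biStabilizer S : Set G) ∩ S = ∅ := by
  refine Set.eq_empty_of_forall_notMem fun h ⟨hh, hS⟩ => h1 ?_
  rw [← (mem_biStabilizer.1 hh).1]
  simpa using hS

theorem cay_adj {G : Type*} [Group G] {S : Set G} {a b : G} :
    (cay G S).Adj a b ↔ a⁻¹ * b ∈ S := by
  constructor
  · rintro ⟨s, hs, rfl⟩
    simpa using hs
  · intro h
    exact ⟨_, h, by simp⟩

theorem cay_injective {G : Type*} [Group G] : Function.Injective (cay G) := by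
  intro S T h
  ext x
  have : (cay G S).Adj 1 x ↔ (cay G T).Adj 1 x := by rw [h]
  simpa [cay_adj] using this

theorem reducible_cay_iff {G : Type*} [Group G] {S : Set G} :
    Reducible (cay G S) ↔ ⊥ < biStabilizer S := by
  simp only [Reducible, cay_adj, bot_lt_iff_ne_bot, Subgroup.ne_bot_iff_exists_ne_one]
  constructor
  · rintro ⟨u, v, huv, hout, hin⟩
    refine ⟨⟨u⁻¹ * v, mem_biStabilizer.2 ⟨fun x => ?_, fun x => ?_⟩⟩, fun h => huv ?_⟩
    · simpa [mul_assoc] using hout (v * x)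
    · simpa [mul_assoc] using (hin (u * x⁻¹)).symm
    · simpa [inv_mul_eq_one] using congrArg Subtype.val h
  · rintro ⟨⟨h, hh⟩, hne⟩
    rw [mem_biStabilizer] at hh
    refine ⟨1, h, fun e => hne (Subtype.ext e.symm), fun w => ?_, fun w => ?_⟩
    · simpa using hh.1 (h⁻¹ * w)
    · simpa using (hh.2 w⁻¹).symm

/-- The map `γ : Cos(G) → Reducible(G)`, `γ(Cos(G,H,S)) = Cay(G,S)`, is well
defined and onto, and `γ(Cos(G,H₁,S₁)) = γ(Cos(G,H₂,S₂))` iff `S₁ = S₂` and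
`⟨H₁,H₂⟩S₁⟨H₁,H₂⟩ = S₁`. -/
theorem statement_10 {G : Type*} [Group G] [Finite G] :
    -- γ is well defined: each element of Cos(G) yields a reducible Cayley digraph of G
    (∀ (H : Subgroup G) (S : Set G), ⊥ < H → (H : Set G) ∩ S = ∅ →
      (H : Set G) * S * (H : Set G) = S → (1 : G) ∉ S ∧ Reducible (cay G S)) ∧
    -- γ is onto
    (∀ S : Set G, (1 : G) ∉ S → Reducible (cay G S) →
      ∃ H : Subgroup G, ⊥ < H ∧ (H : Set G) ∩ S = ∅ ∧ (H : Set G) * S * (H : Set G) = S) ∧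
    -- the fibres of γ
    (∀ (H₁ H₂ : Subgroup G) (S₁ S₂ : Set G),
      ⊥ < H₁ → (H₁ : Set G) ∩ S₁ = ∅ → (H₁ : Set G) * S₁ * (H₁ : Set G) = S₁ →
      ⊥ < H₂ → (H₂ : Set G) ∩ S₂ = ∅ → (H₂ : Set G) * S₂ * (H₂ : Set G) = S₂ →
      (cay G S₁ = cay G S₂ ↔
        S₁ = S₂ ∧ ((H₁ ⊔ H₂ : Subgroup G) : Set G) * S₁ * ((H₁ ⊔ H₂ : Subgroup G) : Set G) = S₁)) := by
  refine ⟨fun H S hH hd hS => ⟨fun h1 => ?_, ?_⟩, fun S h1 hred => ?_, ?_⟩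
  · exact Set.notMem_empty (1 : G) (hd ▸ ⟨H.one_mem, h1⟩)
  · exact reducible_cay_iff.2 (hH.trans_le (mul_mul_eq_iff_le_biStabilizer.1 hS))
  · exact ⟨biStabilizer S, reducible_cay_iff.1 hred, disjoint_biStabilizer h1,
      mul_mul_eq_iff_le_biStabilizer.2 le_rfl⟩
  · intro H₁ H₂ S₁ S₂ _ _ hS₁ _ _ hS₂
    refine ⟨fun h => ?_, fun h => by rw [h.1]⟩
    obtain rfl := cay_injective h
    rw [mul_mul_eq_iff_le_biStabilizer] at hS₁ hS₂ ⊢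
    exact ⟨rfl, sup_le hS₁ hS₂⟩

end DCG
end

section
/- Let G be a finite group and, for i = 1,2, let H_i ≤ G with |H₁| = |H₂| and S_i ⊆ G with H_i ∩ S_i = ∅ and H_iS_iH_i = S_i. Then Cos(G,H₁,S₁) ≅ Cos(G,H₂,S₂) if and only if Cay(G,S₁) ≅ Cay(G,S₂). -/
open scoped Pointwise

namespace DCG

theorem cay_adj_iff {G : Type*} [Group G] (S : Set G) (a b : G) :
    (cay G S).Adj a b ↔ a⁻¹ * b ∈ S := by
  constructor
  · rintro ⟨s, hs, rfl⟩
    simpa using hs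
  · intro h
    exact ⟨_, h, by simp⟩

/-- If `HSH = S`, then `Cay(G,S)` is the pullback of `Cos(G,H,S)` along `G → G/H`. -/
theorem cos_adj_mk_iff_s17 {G : Type*} [Group G] (H : Subgroup G) (S : Set G)
    (hS : (H : Set G) * S * (H : Set G) = S) (a b : G) :
    (cos G H S).Adj (QuotientGroup.mk a) (QuotientGroup.mk b) ↔ (cay G S).Adj a b := by
  rw [cay_adj_iff]
  constructor
  · rintro ⟨g, s, hs, hg, hgs⟩
    have hg' : a⁻¹ * g ∈ H := QuotientGroup.eq.mp hg
    have hgs' : (g * s)⁻¹ * b ∈ H := QuotientGroup.eq.mp hgs.symm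
    rw [← hS]
    exact ⟨(a⁻¹ * g) * s, ⟨_, hg', _, hs, rfl⟩, _, hgs', by group⟩
  · intro h
    exact ⟨a, a⁻¹ * b, h, rfl, by simp⟩

/-- A bijection between the bases of two maps whose corresponding fibres have the same finite
cardinality lifts to a bijection between the total spaces. -/
theorem exists_equiv_lift {A A' B B' : Type*} [Finite A] [Finite A'] (f : A → B) (f' : A' → B')
    (e : B ≃ B') (h : ∀ b, Nat.card {a // f a = b} = Nat.card {a // f' a = e b}) :
    ∃ φ : A ≃ A', ∀ a, f' (φ a) = e (f a) := by
  have F := fun b => (Finite.card_eq.mp (h b)).some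
  refine ⟨(Equiv.sigmaFiberEquiv f).symm.trans
    ((Equiv.sigmaCongr e F).trans (Equiv.sigmaFiberEquiv f')), fun a => ?_⟩
  exact (F (f a) ⟨a, rfl⟩).2

theorem card_fiber_mk {G : Type*} [Group G] (H : Subgroup G) (c : G ⧸ H) :
    Nat.card {g : G // (QuotientGroup.mk g : G ⧸ H) = c} = Nat.card H := by
  exact (QuotientGroup.card_preimage_mk H {c}).trans (by simp)

/-- By Hall's marriage theorem, every permutation of `G` admits a bijection from the left cosets
of `H₁` to the left cosets of `H₂` sending each coset to one that meets its image. -/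
theorem exists_coset_matching {G : Type*} [Group G] [Finite G] (H₁ H₂ : Subgroup G)
    (hcard : Nat.card H₁ = Nat.card H₂) (φ : G ≃ G) :
    ∃ ψ : (G ⧸ H₁) ≃ (G ⧸ H₂), ∀ c, ∃ g : G,
      QuotientGroup.mk g = c ∧ QuotientGroup.mk (φ g) = ψ c := by
  classical
  have := Fintype.ofFinite G
  have := Fintype.ofFinite (G ⧸ H₁)
  have := Fintype.ofFinite (G ⧸ H₂)
  let t : G ⧸ H₁ → Finset (G ⧸ H₂) := fun c =>
    Finset.univ.filter fun d => ∃ g : G, QuotientGroup.mk g = c ∧ QuotientGroup.mk (φ g) = d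
  have hall : ∀ s : Finset (G ⧸ H₁), s.card ≤ (s.biUnion t).card := by
    intro s
    have hmaps : ∀ g ∈ (QuotientGroup.mk ⁻¹' (s : Set (G ⧸ H₁)) : Set G),
        φ g ∈ (QuotientGroup.mk ⁻¹' ((s.biUnion t : Finset _) : Set (G ⧸ H₂)) : Set G) := by
      intro g hg
      simp only [Set.mem_preimage, Finset.mem_coe, Finset.mem_biUnion] at hg ⊢
      exact ⟨_, hg, by simp only [t, Finset.mem_filter_univ]; exact ⟨g, rfl, rfl⟩⟩
    have hle := Nat.card_le_card_of_injective
      (fun g : (QuotientGroup.mk ⁻¹' (s : Set (G ⧸ H₁)) : Set G) =>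
        (⟨φ g, hmaps g g.2⟩ :
          (QuotientGroup.mk ⁻¹' ((s.biUnion t : Finset _) : Set (G ⧸ H₂)) : Set G)))
      (fun x y hxy => Subtype.ext (φ.injective (congrArg Subtype.val hxy)))
    rw [QuotientGroup.card_preimage_mk, QuotientGroup.card_preimage_mk, hcard] at hle
    simpa [Nat.card_eq_fintype_card] using Nat.le_of_mul_le_mul_left hle Nat.card_pos
  obtain ⟨ψ, hinj, hψ⟩ := (Finset.all_card_le_biUnion_card_iff_exists_injective t).mp hall
  have hindex : Nat.card (G ⧸ H₁) = Nat.card (G ⧸ H₂) := by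
    have h := (Subgroup.card_eq_card_quotient_mul_card_subgroup H₁).symm.trans
      (Subgroup.card_eq_card_quotient_mul_card_subgroup H₂)
    rw [hcard] at h
    exact Nat.eq_of_mul_eq_mul_right Nat.card_pos h
  refine ⟨Equiv.ofBijective ψ ((Nat.bijective_iff_injective_and_card ψ).mpr ⟨hinj, hindex⟩),
    fun c => ?_⟩
  have hc := hψ c
  simp only [t, Finset.mem_filter_univ] at hc
  exact hc

/-- For `H_i ≤ G` with `|H₁| = |H₂|`, `H_i ∩ S_i = ∅` and
`H_iS_iH_i = S_i`, one has `Cos(G,H₁,S₁) ≅ Cos(G,H₂,S₂)` iff `Cay(G,S₁) ≅ Cay(G,S₂)`. -/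
theorem statement_17 {G : Type*} [Group G] [Finite G] (H₁ H₂ : Subgroup G)
    (hcard : Nat.card H₁ = Nat.card H₂) (S₁ S₂ : Set G)
    (h₁d : (H₁ : Set G) ∩ S₁ = ∅) (h₁ : (H₁ : Set G) * S₁ * (H₁ : Set G) = S₁)
    (h₂d : (H₂ : Set G) ∩ S₂ = ∅) (h₂ : (H₂ : Set G) * S₂ * (H₂ : Set G) = S₂) :
    Nonempty (Iso (cos G H₁ S₁) (cos G H₂ S₂)) ↔
      Nonempty (Iso (cay G S₁) (cay G S₂)) := by
  constructor
  · rintro ⟨e⟩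
    obtain ⟨φ, hφ⟩ := exists_equiv_lift (QuotientGroup.mk : G → G ⧸ H₁)
      (QuotientGroup.mk : G → G ⧸ H₂) e.toEquiv
      (fun c => by rw [card_fiber_mk, card_fiber_mk, hcard])
    refine ⟨⟨φ, fun u v => ?_⟩⟩
    rw [← cos_adj_mk_iff_s17 H₁ S₁ h₁, ← cos_adj_mk_iff_s17 H₂ S₂ h₂, hφ, hφ]
    exact e.adj_iff _ _
  · rintro ⟨φ⟩
    obtain ⟨ψ, hψ⟩ := exists_coset_matching H₁ H₂ hcard φ.toEquiv
    refine ⟨⟨ψ, fun u v => ?_⟩⟩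
    obtain ⟨a, rfl, ha⟩ := hψ u
    obtain ⟨b, rfl, hb⟩ := hψ v
    rw [← ha, ← hb, cos_adj_mk_iff_s17 H₁ S₁ h₁, cos_adj_mk_iff_s17 H₂ S₂ h₂]
    exact φ.adj_iff a b

end DCG
end
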